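/- Let λ ∈ [1/√5, 1). There exists μ ∈ (0,1/2) such that for every r > 0 and every a ∈ ℝ there exist T > 0 and a λ-eel γ : [0,T] → ℝ³ whose image is contained in the solid bounded cylinder {(x,y,z) ∈ ℝ³ : x² + y² ≤ r², a ≤ z ≤ a + 2πμr}, whose length satisfies ℓ(γ) > 1, whose initial point γ(0) has third coordinate a + 2πμr (upper part of the cylinder), and whose final point γ(T) has third coordinate a (bottom of the cylinder). -/

import Mathlib

open scoped RealInnerProductSpace
open Set

/-- An eel on `[0, T]` together with its right derivative, which is only prescribed on `[0, T)`. -/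
structure IsEelOn (lam T : ℝ) (γ γ' : ℝ → EuclideanSpace ℝ (Fin 3)) : Prop where
  continuousOn : ContinuousOn γ (Icc 0 T)
  deriv : ∀ τ ∈ Ico (0 : ℝ) T, HasDerivWithinAt γ (γ' τ) (Ici τ) τ ∧ γ' τ ≠ 0
  cone : ∀ t ∈ Icc (0 : ℝ) T, ∀ τ ∈ Ico (0 : ℝ) T, t < τ →
    ⟪γ' τ, γ t - γ τ⟫ ≤ lam * ‖γ' τ‖ * ‖γ t - γ τ‖

/-- The curve following `γ` up to time `T` and then `σ`, started at time `T`. -/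
noncomputable def glue (T : ℝ) (γ σ : ℝ → EuclideanSpace ℝ (Fin 3)) (t : ℝ) :
    EuclideanSpace ℝ (Fin 3) :=
  if t < T then γ t else σ (t - T)

lemma glue_of_lt {T t : ℝ} {γ σ : ℝ → EuclideanSpace ℝ (Fin 3)} (h : t < T) :
    glue T γ σ t = γ t := if_pos h

lemma glue_of_ge {T t : ℝ} {γ σ : ℝ → EuclideanSpace ℝ (Fin 3)} (h : T ≤ t) :
    glue T γ σ t = σ (t - T) := if_neg h.not_gt

lemma glue_of_le {T t : ℝ} {γ σ : ℝ → EuclideanSpace ℝ (Fin 3)} (h₀ : σ 0 = γ T) (h : t ≤ T) :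
    glue T γ σ t = γ t := by
  rcases h.lt_or_eq with h | rfl
  · exact glue_of_lt h
  · rw [glue_of_ge le_rfl, sub_self, h₀]

lemma glue_range {T S t : ℝ} {γ σ : ℝ → EuclideanSpace ℝ (Fin 3)} (ht : t ∈ Icc 0 (T + S)) :
    (∃ u ∈ Icc 0 T, glue T γ σ t = γ u) ∨ ∃ s ∈ Icc 0 S, glue T γ σ t = σ s := by
  rcases lt_or_ge t T with h | h
  · exact .inl ⟨t, ⟨ht.1, h.le⟩, glue_of_lt h⟩
  · exact .inr ⟨t - T, ⟨by linarith, by linarith [ht.2]⟩, glue_of_ge h⟩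

lemma IsEelOn.glue {lam T S : ℝ} {γ γ' σ σ' : ℝ → EuclideanSpace ℝ (Fin 3)}
    (h : IsEelOn lam T γ γ') (hT : 0 ≤ T) (hS : 0 ≤ S) (h₀ : σ 0 = γ T)
    (hσ : ∀ s, HasDerivAt σ (σ' s) s) (hσ' : ∀ s, σ' s ≠ 0)
    (hpast : ∀ t ∈ Icc 0 T, ∀ s ∈ Icc 0 S,
      ⟪σ' s, γ t - σ s⟫ ≤ lam * ‖σ' s‖ * ‖γ t - σ s‖)
    (hself : ∀ t s, 0 ≤ t → t < s → s ≤ S →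
      ⟪σ' s, σ t - σ s⟫ ≤ lam * ‖σ' s‖ * ‖σ t - σ s‖) :
    IsEelOn lam (T + S) (glue T γ σ) (_root_.glue T γ' σ') := by
  have hshift : ∀ t, HasDerivAt (fun t ↦ σ (t - T)) (σ' (t - T)) t :=
    fun t ↦ (hσ (t - T)).comp_sub_const t T
  refine ⟨?_, ?_, ?_⟩
  · rw [← Icc_union_Icc_eq_Icc hT (by linarith : T ≤ T + S)]
    refine ContinuousOn.union_of_isClosed ?_ ?_ isClosed_Icc isClosed_Icc
    · exact h.continuousOn.congr fun t ht ↦ glue_of_le h₀ ht.2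
    · exact ContinuousOn.congr (fun t _ ↦ (hshift t).continuousAt.continuousWithinAt)
        fun t ht ↦ glue_of_ge ht.1
  · intro τ hτ
    rcases lt_or_ge τ T with hlt | hge
    · rw [glue_of_lt hlt]
      obtain ⟨hd, hne⟩ := h.deriv τ ⟨hτ.1, hlt⟩
      refine ⟨hd.congr_of_eventuallyEq ?_ (glue_of_lt hlt), hne⟩
      filter_upwards [mem_nhdsWithin_of_mem_nhds (Iio_mem_nhds hlt)] with t ht
      exact glue_of_lt ht
    · rw [glue_of_ge hge]
      exact ⟨(hshift τ).hasDerivWithinAt.congr (fun t ht ↦ glue_of_ge (hge.trans ht))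
        (glue_of_ge hge), hσ' _⟩
  · intro t ht τ hτ htτ
    rcases lt_or_ge τ T with hlt | hge
    · rw [glue_of_lt hlt, glue_of_lt hlt, glue_of_lt (htτ.trans hlt)]
      exact h.cone t ⟨ht.1, (htτ.trans hlt).le⟩ τ ⟨hτ.1, hlt⟩ htτ
    · rw [glue_of_ge hge, glue_of_ge hge]
      rcases lt_or_ge t T with hlt' | hge'
      · rw [glue_of_lt hlt']
        exact hpast t ⟨ht.1, hlt'.le⟩ _ ⟨by linarith, by linarith [hτ.2]⟩
      · rw [glue_of_ge hge']
        exact hself _ _ (by linarith) (by linarith) (by linarith [hτ.2])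

lemma eVariationOn_glue {T S : ℝ} {γ σ : ℝ → EuclideanSpace ℝ (Fin 3)} (hT : 0 ≤ T) (hS : 0 ≤ S)
    (h₀ : σ 0 = γ T) :
    eVariationOn γ (Icc 0 T) + edist (σ 0) (σ S) ≤ eVariationOn (glue T γ σ) (Icc 0 (T + S)) := by
  have hadd := eVariationOn.Icc_add_Icc (glue T γ σ) (s := univ) hT
    (by linarith : T ≤ T + S) (mem_univ T)
  simp only [univ_inter] at hadd
  rw [← hadd]
  gcongr
  · exact (eVariationOn.eq_of_eqOn fun t ht ↦ (glue_of_le h₀ ht.2).symm).le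
  · have := eVariationOn.edist_le (glue T γ σ) (left_mem_Icc.2 (by linarith : T ≤ T + S))
      (right_mem_Icc.2 (by linarith : T ≤ T + S))
    rwa [glue_of_ge le_rfl, glue_of_ge (by linarith), sub_self, add_sub_cancel_left] at this

lemma inner_fin_three (v w : EuclideanSpace ℝ (Fin 3)) :
    ⟪v, w⟫ = v 0 * w 0 + v 1 * w 1 + v 2 * w 2 := by
  simp [PiLp.inner_apply, Fin.sum_univ_three]; ring

lemma norm_sq_fin_three (v : EuclideanSpace ℝ (Fin 3)) :
    ‖v‖ ^ 2 = v 0 ^ 2 + v 1 ^ 2 + v 2 ^ 2 := by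
  simp [EuclideanSpace.real_norm_sq_eq, Fin.sum_univ_three]

lemma inner_le_of_five_mul_sq_le {lam : ℝ} (h₀ : 0 ≤ lam) (hlam : 1 ≤ 5 * lam ^ 2)
    (v w : EuclideanSpace ℝ (Fin 3))
    (h : v 0 * w 0 + v 1 * w 1 + v 2 * w 2 ≤ 0 ∨
      5 * (v 0 * w 0 + v 1 * w 1 + v 2 * w 2) ^ 2 ≤
        (v 0 ^ 2 + v 1 ^ 2 + v 2 ^ 2) * (w 0 ^ 2 + w 1 ^ 2 + w 2 ^ 2)) :
    ⟪v, w⟫ ≤ lam * ‖v‖ * ‖w‖ := by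
  rw [← inner_fin_three, ← norm_sq_fin_three, ← norm_sq_fin_three] at h
  have hpos : 0 ≤ lam * ‖v‖ * ‖w‖ := by positivity
  rcases h with h | h
  · exact h.trans hpos
  · refine le_of_abs_le (abs_le_of_sq_le_sq ?_ hpos)
    have : 0 ≤ ‖v‖ ^ 2 * ‖w‖ ^ 2 := by positivity
    nlinarith

lemma hasDerivAt_vec_three {f g k : ℝ → ℝ} {f' g' k' s : ℝ} (hf : HasDerivAt f f' s)
    (hg : HasDerivAt g g' s) (hk : HasDerivAt k k' s) :
    HasDerivAt (fun s ↦ (!₂[f s, g s, k s] : EuclideanSpace ℝ (Fin 3))) !₂[f', g', k'] s := by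
  have : HasDerivAt (fun s ↦ (![f s, g s, k s] : Fin 3 → ℝ)) ![f', g', k'] s := by
    rw [hasDerivAt_pi]
    intro i
    fin_cases i
    · exact hf
    · exact hg
    · exact hk
  exact (PiLp.continuousLinearEquiv 2 ℝ (fun _ : Fin 3 ↦ ℝ)).symm.hasFDerivAt.comp_hasDerivAt s this

/-- The horizontal ray issued from the cylinder of radius `ρ` in the direction of angle `θ`. -/
noncomputable def ray (ρ θ z s : ℝ) : EuclideanSpace ℝ (Fin 3) :=
  !₂[(ρ + s) * Real.cos θ, (ρ + s) * Real.sin θ, z]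

/-- The helix of radius `R` and slope `c`. -/
noncomputable def helix (R θ z c s : ℝ) : EuclideanSpace ℝ (Fin 3) :=
  !₂[R * Real.cos (θ + s), R * Real.sin (θ + s), z + c * (R * s)]

/-- The velocity of the helix of radius `R` and slope `c`. -/
noncomputable def helixVelocity (R θ c s : ℝ) : EuclideanSpace ℝ (Fin 3) :=
  !₂[-(R * Real.sin (θ + s)), R * Real.cos (θ + s), c * R]

lemma hasDerivAt_ray (ρ θ z s : ℝ) :
    HasDerivAt (ray ρ θ z) !₂[Real.cos θ, Real.sin θ, 0] s := by
  have h : HasDerivAt (fun s ↦ ρ + s) 1 s := (hasDerivAt_id s).const_add ρ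
  have := hasDerivAt_vec_three (h.mul_const (Real.cos θ)) (h.mul_const (Real.sin θ))
    (hasDerivAt_const s z)
  rwa [one_mul, one_mul] at this

lemma hasDerivAt_helix (R θ z c s : ℝ) :
    HasDerivAt (helix R θ z c) (helixVelocity R θ c s) s := by
  have h : HasDerivAt (fun s ↦ θ + s) 1 s := (hasDerivAt_id s).const_add θ
  have hz : HasDerivAt (fun s ↦ z + c * (R * s)) (c * (R * 1)) s :=
    (((hasDerivAt_id s).const_mul R).const_mul c).const_add z
  have := hasDerivAt_vec_three (h.cos.const_mul R) (h.sin.const_mul R) hz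
  rwa [mul_one, mul_one, mul_one, mul_neg] at this

lemma radial_ne_zero (θ : ℝ) :
    (!₂[Real.cos θ, Real.sin θ, 0] : EuclideanSpace ℝ (Fin 3)) ≠ 0 := by
  intro h
  have := norm_sq_fin_three (!₂[Real.cos θ, Real.sin θ, 0] : EuclideanSpace ℝ (Fin 3))
  simp only [Matrix.cons_val_zero, Matrix.cons_val_one, Matrix.cons_val] at this
  rw [h, Real.cos_sq_add_sin_sq] at this
  norm_num at this

lemma helixVelocity_ne_zero {R c : ℝ} (hR : 0 < R) (hc : c ^ 2 = 4 / 25) (θ s : ℝ) :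
    helixVelocity R θ c s ≠ 0 := by
  intro h
  have := congrArg (fun v : EuclideanSpace ℝ (Fin 3) ↦ v 2) h
  simp only [helixVelocity, PiLp.zero_apply] at this
  have : c * R = 0 := by simpa using this
  rcases mul_eq_zero.1 this with h | h
  · norm_num [h] at hc
  · exact hR.ne' h

/-- A point of the past in the cylinder of radius `ρ` is behind the outward radial direction. -/
lemma inner_radial_nonpos {ρ θ s : ℝ} (hρ : 0 ≤ ρ) (hs : 0 ≤ s) (z : ℝ)
    {p : EuclideanSpace ℝ (Fin 3)} (hp : p 0 ^ 2 + p 1 ^ 2 ≤ ρ ^ 2) :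
    ⟪(!₂[Real.cos θ, Real.sin θ, 0] : EuclideanSpace ℝ (Fin 3)), p - ray ρ θ z s⟫ ≤ 0 := by
  rw [inner_fin_three]
  have hsc := Real.sin_sq_add_cos_sq θ
  have key : Real.cos θ * p 0 + Real.sin θ * p 1 ≤ ρ := by
    refine le_of_abs_le (abs_le_of_sq_le_sq ?_ hρ)
    nlinarith [sq_nonneg (Real.cos θ * p 1 - Real.sin θ * p 0)]
  simp [ray]
  nlinarith

/-- A helix of slope `2 / 5` keeps any point of a six times thinner coaxial cylinder outside its
forward cone. -/
lemma helix_core {lam R c : ℝ} (h₀ : 0 ≤ lam) (hlam : 1 ≤ 5 * lam ^ 2) (hR : 0 < R)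
    (hc : c ^ 2 = 4 / 25) (θ z s : ℝ) {p : EuclideanSpace ℝ (Fin 3)}
    (hp : p 0 ^ 2 + p 1 ^ 2 ≤ (R / 6) ^ 2) :
    ⟪helixVelocity R θ c s, p - helix R θ z c s⟫ ≤
      lam * ‖helixVelocity R θ c s‖ * ‖p - helix R θ z c s‖ := by
  refine inner_le_of_five_mul_sq_le h₀ hlam _ _ (.inr ?_)
  simp only [helixVelocity, helix, PiLp.sub_apply]
  simp only [Matrix.cons_val_zero, Matrix.cons_val_one, Matrix.cons_val]
  have hsc := Real.sin_sq_add_cos_sq (θ + s)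
  generalize Real.sin (θ + s) = y at *
  generalize Real.cos (θ + s) = x at *
  generalize p 2 - (z + c * (R * s)) = D
  generalize p.ofLp 0 = u at *
  generalize p.ofLp 1 = v at *
  obtain ⟨a, ha⟩ : ∃ a, a = x * u + y * v := ⟨_, rfl⟩
  obtain ⟨b, hb⟩ : ∃ b, b = x * v - y * u := ⟨_, rfl⟩
  have hab : a ^ 2 + b ^ 2 ≤ (R / 6) ^ 2 := by
    have : a ^ 2 + b ^ 2 = (y ^ 2 + x ^ 2) * (u ^ 2 + v ^ 2) := by rw [ha, hb]; ring
    rw [this, hsc, one_mul]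
    exact hp
  have haR : a ≤ R / 6 := le_of_abs_le (abs_le_of_sq_le_sq (by nlinarith) (by positivity))
  have hbR : 25 * b ^ 2 ≤ (R - a) ^ 2 := by nlinarith [sq_nonneg a]
  have key : 5 * (b + c * D) ^ 2 ≤ (1 + c ^ 2) * ((R - a) ^ 2 + b ^ 2 + D ^ 2) := by
    have hcD : (c * D) ^ 2 = 4 / 25 * D ^ 2 := by rw [mul_pow, hc]
    rw [hc]
    nlinarith [sq_nonneg (b - 9 / 20 * (c * D)), sq_nonneg b]
  have hinner : -(R * y) * (u - R * x) + R * x * (v - R * y) + c * R * D = R * (b + c * D) := by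
    rw [hb]; ring
  have hvel : (-(R * y)) ^ 2 + (R * x) ^ 2 + (c * R) ^ 2 = R ^ 2 * (1 + c ^ 2) := by
    rw [← hsc]; ring
  have hdist : (u - R * x) ^ 2 + (v - R * y) ^ 2 + D ^ 2 = (R - a) ^ 2 + b ^ 2 + D ^ 2 := by
    rw [ha, hb]
    linear_combination (R ^ 2 - u ^ 2 - v ^ 2) * hsc
  rw [hinner, hvel, hdist]
  nlinarith [mul_le_mul_of_nonneg_left key (sq_nonneg R)]

/-- A helix of slope `2 / 5` keeps outside its forward cone any point located on a horizontal
radius ending at an earlier point of the helix. -/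
lemma helix_past {lam R c : ℝ} (h₀ : 0 ≤ lam) (hlam : 1 ≤ 5 * lam ^ 2) (hR : 0 < R)
    (hc : c ^ 2 = 4 / 25) (θ z : ℝ) {a t s : ℝ} (ha : 0 ≤ a) (haR : a ≤ R) (hts : t ≤ s) :
    ⟪helixVelocity R θ c s,
        !₂[a * Real.cos (θ + t), a * Real.sin (θ + t), z + c * (R * t)] - helix R θ z c s⟫ ≤
      lam * ‖helixVelocity R θ c s‖ *
        ‖!₂[a * Real.cos (θ + t), a * Real.sin (θ + t), z + c * (R * t)] - helix R θ z c s‖ := by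
  refine inner_le_of_five_mul_sq_le h₀ hlam _ _ ?_
  simp only [helixVelocity, helix, PiLp.sub_apply]
  simp only [Matrix.cons_val_zero, Matrix.cons_val_one, Matrix.cons_val]
  have hsc := Real.sin_sq_add_cos_sq (θ + s)
  have hsin : Real.sin (s - t) = Real.sin (θ + s) * Real.cos (θ + t) -
      Real.cos (θ + s) * Real.sin (θ + t) := by
    rw [← Real.sin_sub]; congr 1; ring
  have hone := Real.neg_one_le_sin (s - t)
  have hnonneg : s - t ≤ Real.pi → 0 ≤ Real.sin (s - t) :=
    Real.sin_nonneg_of_nonneg_of_le_pi (by linarith)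
  generalize Real.sin (s - t) = w at *
  generalize Real.sin (θ + s) = y at *
  generalize Real.cos (θ + s) = x at *
  generalize Real.sin (θ + t) = y' at *
  generalize Real.cos (θ + t) = x' at *
  obtain ⟨d, hd⟩ : ∃ d, d = s - t := ⟨_, rfl⟩
  have hinner : -(R * y) * (a * x' - R * x) + R * x * (a * y' - R * y) +
      c * R * (z + c * (R * t) - (z + c * (R * s))) = R * (-(a * w) - 4 / 25 * (R * d)) := by
    rw [hsin, hd, ← hc]; ring
  have hvel : (-(R * y)) ^ 2 + (R * x) ^ 2 + (c * R) ^ 2 = R ^ 2 * (29 / 25) := by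
    rw [mul_pow c, hc]
    linear_combination R ^ 2 * hsc
  have hheight : (z + c * (R * t) - (z + c * (R * s))) ^ 2 = 4 / 25 * (R * d) ^ 2 := by
    rw [hd, ← hc]; ring
  rw [hinner, hvel, hheight]
  rw [← hd] at hnonneg
  have hd₀ : 0 ≤ d := by linarith
  rcases le_or_gt (-(a * w) - 4 / 25 * (R * d)) 0 with hX | hX
  · exact .inl (mul_nonpos_of_nonneg_of_nonpos hR.le hX)
  right
  have hpi : Real.pi < d := by
    by_contra! hle
    nlinarith [mul_nonneg ha (hnonneg hle), mul_nonneg hR.le hd₀]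
  have hX' : -(a * w) - 4 / 25 * (R * d) ≤ 19 / 100 * (R * d) := by
    have : 3 < d := Real.pi_gt_three.trans hpi
    nlinarith [Real.pi_gt_d2]
  have hsq : (-(a * w) - 4 / 25 * (R * d)) ^ 2 ≤ (19 / 100 * (R * d)) ^ 2 :=
    pow_le_pow_left₀ hX.le hX' 2
  rw [mul_pow]
  nlinarith [mul_le_mul_of_nonneg_left hsq (sq_nonneg R),
    mul_nonneg (sq_nonneg R) (sq_nonneg (a * x' - R * x)),
    mul_nonneg (sq_nonneg R) (sq_nonneg (a * y' - R * y)),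
    mul_nonneg (sq_nonneg R) (sq_nonneg (R * d))]

/-- The height of the end point after `n` passes between the two ends `a + h` and `a`. -/
noncomputable def endHeight (a h : ℝ) (n : ℕ) : ℝ := if Even n then a + h else a

lemma endHeight_succ (a h : ℝ) (n : ℕ) :
    endHeight a h (n + 1) = endHeight a h n + h ∧ endHeight a h n = a ∨
      endHeight a h (n + 1) = endHeight a h n - h ∧ endHeight a h n = a + h := by
  by_cases hn : Even n <;> simp [endHeight, Nat.even_add_one, hn]

/-- An eel joining the two ends of a cylinder of height `h` in `n` passes of increasing radii. -/
lemma exists_eel_passes {lam a h : ℝ} (h₀ : 0 ≤ lam) (hlam : 1 ≤ 5 * lam ^ 2) (hh : 0 < h)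
    (n : ℕ) {ρ : ℝ} (hρ : 0 < ρ) :
    ∃ (T θ : ℝ) (γ γ' : ℝ → EuclideanSpace ℝ (Fin 3)), 0 ≤ T ∧ IsEelOn lam T γ γ' ∧
      (∀ t ∈ Icc 0 T, (γ t 0) ^ 2 + (γ t 1) ^ 2 ≤ ρ ^ 2 ∧ a ≤ γ t 2 ∧ γ t 2 ≤ a + h) ∧
      γ 0 2 = a + h ∧ γ T = ray ρ θ (endHeight a h n) 0 ∧
      ENNReal.ofReal (n * h) ≤ eVariationOn γ (Icc 0 T) := by
  induction n generalizing ρ with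
  | zero =>
    refine ⟨0, 0, fun _ ↦ ray ρ 0 (a + h) 0, fun _ ↦ 0, le_rfl, ⟨continuousOn_const, ?_, ?_⟩,
      ?_, ?_, ?_, ?_⟩
    · simp
    · simp
    · simp [ray, hh.le]
    · simp [ray]
    · simp [endHeight]
    · simp
  | succ n ih =>
    obtain ⟨T, θ, γ, γ', hT, heel, hcyl, hstart, hend, hlen⟩ := ih (ρ := ρ / 6) (by positivity)
    set z := endHeight a h n with hz
    obtain ⟨c, hc, hcz, hcyl'⟩ : ∃ c : ℝ, c ^ 2 = 4 / 25 ∧ z + c * (5 / 2 * h) =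
        endHeight a h (n + 1) ∧ ∀ u ∈ Icc 0 (5 / 2 * h), a ≤ z + c * u ∧ z + c * u ≤ a + h := by
      rcases endHeight_succ a h n with ⟨h1, h2⟩ | ⟨h1, h2⟩
      · refine ⟨2 / 5, by norm_num, by rw [h1]; ring, fun u hu ↦ ?_⟩
        rw [hz, h2]
        constructor <;> linarith [hu.1, hu.2]
      · refine ⟨-(2 / 5), by norm_num, by rw [h1]; ring, fun u hu ↦ ?_⟩
        rw [hz, h2]
        constructor <;> linarith [hu.1, hu.2]
    have hzmem : a ≤ z ∧ z ≤ a + h := by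
      simpa using hcyl' 0 ⟨le_rfl, by positivity⟩
    have hS : 0 ≤ 5 / 2 * h / ρ := by positivity
    have hρS : ρ * (5 / 2 * h / ρ) = 5 / 2 * h := by field_simp
    have hray₀ : ray (ρ / 6) θ z 0 = γ T := hend.symm
    have heel₁ := heel.glue (S := 5 / 6 * ρ) hT (by positivity) hray₀
      (hasDerivAt_ray (ρ / 6) θ z) (fun _ ↦ radial_ne_zero θ)
      (fun t ht s hs ↦ (inner_radial_nonpos (by positivity) hs.1 z (hcyl t ht).1).trans
        (by positivity))
      (fun t s ht hts hs ↦ by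
        refine LE.le.trans ?_ (by positivity)
        rw [inner_fin_three]
        simp only [ray, PiLp.sub_apply]
        simp only [Matrix.cons_val_zero, Matrix.cons_val_one, Matrix.cons_val]
        nlinarith [sq_nonneg (Real.cos θ), sq_nonneg (Real.sin θ)])
    have hvar₁ := eVariationOn_glue (S := 5 / 6 * ρ) hT (by positivity) hray₀
    have hT₁ : 0 ≤ T + 5 / 6 * ρ := by positivity
    have hpast : ∀ t ∈ Icc 0 (T + 5 / 6 * ρ),
        (∃ u ∈ Icc 0 T, glue T γ (ray (ρ / 6) θ z) t = γ u) ∨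
        ∃ b, 0 ≤ b ∧ b ≤ ρ ∧ glue T γ (ray (ρ / 6) θ z) t =
          !₂[b * Real.cos θ, b * Real.sin θ, z] := by
      intro t ht
      rcases glue_range ht with hu | ⟨s, hs, hts⟩
      · exact .inl hu
      · exact .inr ⟨ρ / 6 + s, by linarith [hs.1], by linarith [hs.2], hts⟩
    have hstart₁ : glue T γ (ray (ρ / 6) θ z) 0 = γ 0 := glue_of_le hray₀ hT
    have hend₁ : glue T γ (ray (ρ / 6) θ z) (T + 5 / 6 * ρ) = helix ρ θ z c 0 := by
      rw [glue_of_ge (by linarith), add_sub_cancel_left]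
      simp only [ray, helix, add_zero, mul_zero]
      ring_nf
    generalize glue T γ (ray (ρ / 6) θ z) = γ₁ at *
    generalize T + 5 / 6 * ρ = T₁ at *
    have heel₂ := heel₁.glue (σ := helix ρ θ z c) hT₁ hS hend₁.symm (hasDerivAt_helix ρ θ z c)
      (helixVelocity_ne_zero hρ hc θ)
      (fun t ht s hs ↦ by
        rcases hpast t ht with ⟨u, hu, htu⟩ | ⟨b, hb, hbρ, htb⟩
        · rw [htu]
          exact helix_core h₀ hlam hρ hc θ z s (hcyl u hu).1
        · rw [htb]
          simpa using helix_past h₀ hlam hρ hc θ z hb hbρ hs.1)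
      (fun t s _ hts _ ↦ helix_past h₀ hlam hρ hc θ z hρ.le le_rfl hts.le)
    have hvar₂ := eVariationOn_glue (σ := helix ρ θ z c) hT₁ hS hend₁.symm
    refine ⟨_, θ + 5 / 2 * h / ρ, _, _, add_nonneg hT₁ hS, heel₂, ?_, ?_, ?_, ?_⟩
    · intro t ht
      rcases glue_range ht with ⟨u, hu, htu⟩ | ⟨s, hs, hts⟩
      · rw [htu]
        rcases hpast u hu with ⟨v, hv, huv⟩ | ⟨b, hb, hbρ, hub⟩
        · rw [huv]
          obtain ⟨h1, h2⟩ := hcyl v hv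
          exact ⟨h1.trans (by nlinarith), h2⟩
        · rw [hub]
          refine ⟨?_, by simpa using hzmem⟩
          simp only [Matrix.cons_val_zero, Matrix.cons_val_one]
          rw [mul_pow, mul_pow, ← mul_add, Real.cos_sq_add_sin_sq, mul_one]
          exact pow_le_pow_left₀ hb hbρ 2
      · rw [hts]
        refine ⟨?_, ?_⟩
        · simp only [helix, Matrix.cons_val_zero, Matrix.cons_val_one]
          nlinarith [Real.sin_sq_add_cos_sq (θ + s)]
        · refine hcyl' (ρ * s) ⟨mul_nonneg hρ.le hs.1, ?_⟩
          rw [← hρS]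
          exact mul_le_mul_of_nonneg_left hs.2 hρ.le
    · rw [glue_of_le hend₁.symm hT₁, hstart₁, hstart]
    · rw [glue_of_ge (by linarith), add_sub_cancel_left, helix, ray, hρS, hcz, add_zero]
    · refine le_trans ?_ hvar₂
      have hdist : ENNReal.ofReal h ≤
          edist (helix ρ θ z c 0) (helix ρ θ z c (5 / 2 * h / ρ)) := by
        rw [edist_dist]
        refine ENNReal.ofReal_le_ofReal ?_
        rw [dist_eq_norm]
        refine le_of_abs_le (abs_le_of_sq_le_sq ?_ (norm_nonneg _))
        rw [norm_sq_fin_three]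
        have h2 : (helix ρ θ z c 0 - helix ρ θ z c (5 / 2 * h / ρ)) 2 = -(c * (5 / 2 * h)) := by
          simp [helix, hρS]
        have h3 : (-(c * (5 / 2 * h))) ^ 2 = h ^ 2 := by
          rw [neg_sq, mul_pow, hc]; ring
        rw [h2, h3]
        nlinarith [sq_nonneg ((helix ρ θ z c 0 - helix ρ θ z c (5 / 2 * h / ρ)) 0),
          sq_nonneg ((helix ρ θ z c 0 - helix ρ θ z c (5 / 2 * h / ρ)) 1)]
      have hsplit : ((n + 1 : ℕ) : ℝ) * h = n * h + h := by push_cast; ring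
      rw [hsplit, ENNReal.ofReal_add (by positivity) hh.le]
      exact add_le_add (hlen.trans (le_self_add.trans hvar₁)) hdist

/-- **arbitrarily long eels inside a bounded cylinder.** For
`λ ∈ [1/√5, 1)` there is `μ ∈ (0,1/2)` such that for every `r > 0` and `a ∈ ℝ` there is a
`λ`-eel `γ : [0,T] → ℝ³` contained in the solid cylinder
`{x² + y² ≤ r², a ≤ z ≤ a + 2πμr}`, of length `> 1`, starting at height `a + 2πμr` and
ending at height `a`. -/
theorem exists_long_eel_in_cylinder (lam : ℝ)
    (hlam₁ : 1 / Real.sqrt 5 ≤ lam) (hlam₂ : lam < 1) :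
    ∃ μ : ℝ, 0 < μ ∧ μ < 1 / 2 ∧
      ∀ r : ℝ, 0 < r → ∀ a : ℝ,
        ∃ (T : ℝ) (γ γ' : ℝ → EuclideanSpace ℝ (Fin 3)),
          0 < T ∧
          ContinuousOn γ (Set.Icc 0 T) ∧
          (∀ τ ∈ Set.Icc (0 : ℝ) T,
            HasDerivWithinAt γ (γ' τ) (Set.Icc τ T) τ ∧ γ' τ ≠ 0) ∧
          (∀ t ∈ Set.Icc (0 : ℝ) T, ∀ τ ∈ Set.Icc (0 : ℝ) T, t < τ →
            ⟪γ' τ, γ t - γ τ⟫ ≤ lam * ‖γ' τ‖ * ‖γ t - γ τ‖) ∧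
          (∀ t ∈ Set.Icc (0 : ℝ) T,
            (γ t 0) ^ 2 + (γ t 1) ^ 2 ≤ r ^ 2 ∧
            a ≤ γ t 2 ∧ γ t 2 ≤ a + 2 * Real.pi * μ * r) ∧
          1 < eVariationOn γ (Set.Icc 0 T) ∧
          γ 0 2 = a + 2 * Real.pi * μ * r ∧
          γ T 2 = a := by
  have h₀ : 0 ≤ lam := le_trans (by positivity) hlam₁
  have hlam : 1 ≤ 5 * lam ^ 2 := by
    have := pow_le_pow_left₀ (by positivity) hlam₁ 2
    rw [div_pow, Real.sq_sqrt (by norm_num)] at this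
    linarith
  refine ⟨2 / 5, by norm_num, by norm_num, fun r hr a ↦ ?_⟩
  set h := 2 * Real.pi * (2 / 5) * r
  have hpos : 0 < h := by positivity
  obtain ⟨k, hk⟩ := exists_nat_gt (1 / h)
  obtain ⟨T, θ, γ, γ', hT, heel, hcyl, hstart, hend, hlen⟩ :=
    exists_eel_passes (a := a) h₀ hlam hpos (2 * k + 1) hr
  have hodd : endHeight a h (2 * k + 1) = a := by simp [endHeight]
  rw [hodd] at hend
  have hend₂ : γ T 2 = a := by rw [hend]; simp [ray]
  have hT₀ : 0 < T := by
    refine hT.lt_of_ne fun hT₀ ↦ ?_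
    rw [← hT₀, hstart] at hend₂
    linarith
  refine ⟨T, γ, Function.update γ' T !₂[Real.cos θ, Real.sin θ, 0], hT₀, heel.continuousOn,
    ?_, ?_, hcyl, ?_, hstart, hend₂⟩
  · intro τ hτ
    rcases hτ.2.lt_or_eq with hlt | rfl
    · rw [Function.update_of_ne hlt.ne]
      obtain ⟨hd, hne⟩ := heel.deriv τ ⟨hτ.1, hlt⟩
      exact ⟨hd.mono Icc_subset_Ici_self, hne⟩
    · rw [Function.update_self, Icc_self]
      exact ⟨HasFDerivWithinAt.of_subsingleton subsingleton_singleton, radial_ne_zero θ⟩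
  · intro t ht τ hτ htτ
    rcases hτ.2.lt_or_eq with hlt | rfl
    · rw [Function.update_of_ne hlt.ne]
      exact heel.cone t ht τ ⟨hτ.1, hlt⟩ htτ
    · rw [Function.update_self]
      refine LE.le.trans ?_ (by positivity)
      rw [hend]
      exact inner_radial_nonpos hr.le le_rfl a (hcyl t ht).1
  · refine lt_of_lt_of_le ?_ hlen
    rw [← ENNReal.ofReal_one]
    refine ENNReal.ofReal_lt_ofReal_iff (by positivity) |>.2 ?_
    rw [div_lt_iff₀ hpos] at hk
    push_cast
    nlinarith
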